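/- Consider the linear time-varying system ẋ(s) = A(s)x(s) + B(s)u(s) with A, B continuous, input set E(p,P) with P symmetric positive definite, terminal set 𝒳 = E(x_e, X_e) with X_e symmetric positive definite, and backwards reachable set 𝒢(t) = {x ∈ ℝⁿ | ∃ measurable u : [t,T] → E(p,P) driving x at time t into 𝒳 at time T}. Fix t ∈ [0,T] and an index i; let q_i, Q_i, S_i be as in the under-approximating final value problem (with Q_i(s) symmetric positive definite for all s), and suppose x* : [t,T] → ℝⁿ and λ : [t,T] → ℝⁿ satisfy, for a.e. s ∈ (t,T): ẋ*(s) = A(s)x*(s) + B(s)u*(s) with u*(s) ∈ argmax_{u ∈ E(p,P)} ⟨−λ(s), B(s)u⟩, λ̇(s) = −A(s)ᵀ λ(s), x*(T) ∈ ∂𝒳, λ(T) = 2 X_e⁻¹ (x*(T) − x_e), and that S_i satisfies S_i(s)ŵ_i(s)/‖ŵ_i(s)‖₂ = 𝒬_{i,*}(s)^{1/2}ŵ_i(s)/‖𝒬_{i,*}(s)^{1/2}ŵ_i(s)‖₂ whenever 𝒬_{i,*}(s)^{1/2}ŵ_i(s) ≠ 0, where ŵ_i(s) = Q_i(s)^{-1/2}(x*(s)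 − q_i(s)). Then x*(s) lies on the boundary of E(q_i(s), Q_i(s)) and on the boundary of 𝒢(s), for all s ∈ [t,T]. -/

import Mathlib

open scoped RealInnerProductSpace
open Matrix Set MeasureTheory

noncomputable section

/-- Action of a matrix on a Euclidean vector. -/
def mv {k l : ℕ} (M : Matrix (Fin k) (Fin l) ℝ) (x : EuclideanSpace ℝ (Fin l)) :
    EuclideanSpace ℝ (Fin k) :=
  (EuclideanSpace.equiv (Fin k) ℝ).symm (M.mulVec ((EuclideanSpace.equiv (Fin l) ℝ) x))

/-- The ellipsoid `E(q, Q) = {x | ⟨x − q, Q⁻¹(x − q)⟩ ≤ 1}`. -/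
def ellipsoid {k : ℕ} (q : EuclideanSpace ℝ (Fin k)) (Q : Matrix (Fin k) (Fin k) ℝ) :
    Set (EuclideanSpace ℝ (Fin k)) :=
  {x | ⟪x - q, mv Q⁻¹ (x - q)⟫ ≤ 1}

/-- A measurable control valued in `U` on `[t, T]`. -/
def Admissible {α : Type*} [MeasurableSpace α] (U : Set α) (t T : ℝ) (u : ℝ → α) : Prop :=
  Measurable u ∧ ∀ s ∈ Set.Icc t T, u s ∈ U

/-- The backwards reachable set of the LTV system `ẋ = A(s)x + B(s)u`, `u(s) ∈ E(p,P)`,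
with target `E(xe, Xe)` at time `T`, evaluated at time `t`. -/
def ReachLTV {n m : ℕ} (A : ℝ → Matrix (Fin n) (Fin n) ℝ) (B : ℝ → Matrix (Fin n) (Fin m) ℝ)
    (p : EuclideanSpace ℝ (Fin m)) (P : Matrix (Fin m) (Fin m) ℝ)
    (xe : EuclideanSpace ℝ (Fin n)) (Xe : Matrix (Fin n) (Fin n) ℝ)
    (T t : ℝ) : Set (EuclideanSpace ℝ (Fin n)) :=
  {x | ∃ (u : ℝ → EuclideanSpace ℝ (Fin m)) (X : ℝ → EuclideanSpace ℝ (Fin n)),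
    Admissible (ellipsoid p P) t T u ∧ ContinuousOn X (Set.Icc t T) ∧
    (∀ s ∈ Set.Icc t T, X s = x + ∫ r in t..s, (mv (A r) (X r) + mv (B r) (u r))) ∧
    X T ∈ ellipsoid xe Xe}


lemma mv_apply {k l : ℕ} (M : Matrix (Fin k) (Fin l) ℝ) (x : EuclideanSpace ℝ (Fin l)) (i : Fin k) :
    mv M x i = ∑ j, M i j * x j := by
  simp [mv, Matrix.mulVec, dotProduct]

lemma mv_mul {k l o : ℕ} (M : Matrix (Fin k) (Fin l) ℝ) (N : Matrix (Fin l) (Fin o) ℝ)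
    (x : EuclideanSpace ℝ (Fin o)) : mv (M * N) x = mv M (mv N x) := by
  show (EuclideanSpace.equiv (Fin k) ℝ).symm _ = (EuclideanSpace.equiv (Fin k) ℝ).symm _
  rw [← Matrix.mulVec_mulVec]; rfl

lemma mv_zero {k l : ℕ} (M : Matrix (Fin k) (Fin l) ℝ) : mv M 0 = 0 := by
  ext i; simp [mv_apply]

lemma mv_neg {k l : ℕ} (M : Matrix (Fin k) (Fin l) ℝ) (x : EuclideanSpace ℝ (Fin l)) :
    mv M (-x) = -mv M x := by
  ext i; simp [mv_apply]

lemma mv_one {k : ℕ} (x : EuclideanSpace ℝ (Fin k)) : mv 1 x = x := by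
  simp [mv]

lemma mv_add {k l : ℕ} (M : Matrix (Fin k) (Fin l) ℝ) (x y : EuclideanSpace ℝ (Fin l)) :
    mv M (x + y) = mv M x + mv M y := by
  ext i; simp [mv_apply, mul_add, Finset.sum_add_distrib]

lemma mv_sub {k l : ℕ} (M : Matrix (Fin k) (Fin l) ℝ) (x y : EuclideanSpace ℝ (Fin l)) :
    mv M (x - y) = mv M x - mv M y := by
  ext i; simp [mv_apply, mul_sub, Finset.sum_sub_distrib]

lemma mv_smul {k l : ℕ} (M : Matrix (Fin k) (Fin l) ℝ) (c : ℝ) (x : EuclideanSpace ℝ (Fin l)) :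
    mv M (c • x) = c • mv M x := by
  ext i; simp [mv_apply, Finset.mul_sum, mul_left_comm]

lemma add_mv {k l : ℕ} (M N : Matrix (Fin k) (Fin l) ℝ) (x : EuclideanSpace ℝ (Fin l)) :
    mv (M + N) x = mv M x + mv N x := by
  ext i; simp [mv_apply, add_mul, Finset.sum_add_distrib]

lemma sub_mv {k l : ℕ} (M N : Matrix (Fin k) (Fin l) ℝ) (x : EuclideanSpace ℝ (Fin l)) :
    mv (M - N) x = mv M x - mv N x := by
  ext i; simp [mv_apply, sub_mul, Finset.sum_sub_distrib]

lemma inner_eq_sum {k : ℕ} (x y : EuclideanSpace ℝ (Fin k)) : ⟪x, y⟫ = ∑ i, x i * y i := by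
  simp [PiLp.inner_apply, mul_comm]

lemma inner_mv {k l : ℕ} (M : Matrix (Fin k) (Fin l) ℝ) (x : EuclideanSpace ℝ (Fin k))
    (y : EuclideanSpace ℝ (Fin l)) : ⟪x, mv M y⟫ = ⟪mv Mᵀ x, y⟫ := by
  simp only [inner_eq_sum, mv_apply, Finset.mul_sum, Finset.sum_mul, Matrix.transpose_apply]
  rw [Finset.sum_comm]
  refine Finset.sum_congr rfl fun i _ => Finset.sum_congr rfl fun j _ => by ring

lemma inner_mv_eq_sum {k l : ℕ} (M : Matrix (Fin k) (Fin l) ℝ) (x : EuclideanSpace ℝ (Fin k))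
    (y : EuclideanSpace ℝ (Fin l)) : ⟪x, mv M y⟫ = ∑ i, ∑ j, x i * (M i j * y j) := by
  simp only [inner_eq_sum, mv_apply, Finset.mul_sum]

lemma continuous_mv {k l : ℕ} : Continuous
    (fun z : Matrix (Fin k) (Fin l) ℝ × EuclideanSpace ℝ (Fin l) => mv z.1 z.2) := by
  unfold mv
  fun_prop

lemma posDef_symm {k : ℕ} {M : Matrix (Fin k) (Fin k) ℝ} (h : M.PosSemidef) : Mᵀ = M := by
  have := h.1
  rwa [Matrix.IsHermitian, Matrix.conjTranspose_eq_transpose_of_trivial] at this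

lemma posSemidef_inner {k : ℕ} {M : Matrix (Fin k) (Fin k) ℝ} (h : M.PosSemidef)
    (x : EuclideanSpace ℝ (Fin k)) : 0 ≤ ⟪x, mv M x⟫ := by
  have := h.dotProduct_mulVec_nonneg (x : Fin k → ℝ)
  rw [inner_eq_sum]
  simpa [dotProduct, mv_apply, Matrix.mulVec] using this

lemma posDef_inner {k : ℕ} {M : Matrix (Fin k) (Fin k) ℝ} (h : M.PosDef)
    {x : EuclideanSpace ℝ (Fin k)} (hx : x ≠ 0) : 0 < ⟪x, mv M x⟫ := by
  have := h.dotProduct_mulVec_pos (x := (x : Fin k → ℝ)) (by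
    intro h0; apply hx; ext i; exact congrFun h0 i)
  rw [inner_eq_sum]
  simpa [dotProduct, mv_apply, Matrix.mulVec] using this

lemma mv_mv_inv {k : ℕ} {M : Matrix (Fin k) (Fin k) ℝ} (h : IsUnit M.det)
    (x : EuclideanSpace ℝ (Fin k)) : mv M (mv M⁻¹ x) = x := by
  rw [← mv_mul, Matrix.mul_nonsing_inv _ h, mv_one]

lemma mv_inv_mv {k : ℕ} {M : Matrix (Fin k) (Fin k) ℝ} (h : IsUnit M.det)
    (x : EuclideanSpace ℝ (Fin k)) : mv M⁻¹ (mv M x) = x := by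
  rw [← mv_mul, Matrix.nonsing_inv_mul _ h, mv_one]

lemma isUnit_det {k : ℕ} {M : Matrix (Fin k) (Fin k) ℝ} (h : M.PosDef) : IsUnit M.det :=
  h.det_pos.ne'.isUnit

lemma inner_symm {k : ℕ} {M : Matrix (Fin k) (Fin k) ℝ} (h : Mᵀ = M)
    (x y : EuclideanSpace ℝ (Fin k)) : ⟪x, mv M y⟫ = ⟪mv M x, y⟫ := by
  rw [inner_mv, h]

/-- Cauchy–Schwarz in the metric of `P`, polynomial form. -/
lemma cs_sq {k : ℕ} {P : Matrix (Fin k) (Fin k) ℝ} (hP : P.PosDef)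
    (a d : EuclideanSpace ℝ (Fin k)) :
    ⟪a, d⟫ ^ 2 ≤ ⟪a, mv P a⟫ * ⟪d, mv P⁻¹ d⟫ := by
  have hs := posDef_symm hP.posSemidef
  set e := mv P⁻¹ d with he
  have hd : d = mv P e := (mv_mv_inv (isUnit_det hP) d).symm
  have key : ∀ c : ℝ, 0 ≤ ⟪d, e⟫ * (c * c) + (2 * ⟪a, d⟫) * c + ⟪a, mv P a⟫ := by
    intro c
    have h0 := posSemidef_inner hP.posSemidef (a + c • e)
    rw [mv_add, mv_smul, ← hd, inner_add_left, inner_add_right, inner_add_right,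
      real_inner_smul_left, real_inner_smul_left, real_inner_smul_right, real_inner_smul_right,
      inner_symm hs e a, ← hd, real_inner_comm a d, real_inner_comm d e] at h0
    linarith
  have := discrim_le_zero key
  unfold discrim at this
  nlinarith

lemma cs_abs {k : ℕ} {P : Matrix (Fin k) (Fin k) ℝ} (hP : P.PosDef)
    (a d : EuclideanSpace ℝ (Fin k)) (hd : ⟪d, mv P⁻¹ d⟫ ≤ 1) :
    |⟪a, d⟫| ≤ √⟪a, mv P a⟫ := by
  apply Real.abs_le_sqrt
  have h1 := cs_sq hP a d
  have h2 := posSemidef_inner hP.posSemidef a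
  nlinarith

lemma max_attained {n m : ℕ} {P : Matrix (Fin m) (Fin m) ℝ} (hP : P.PosDef)
    (B : Matrix (Fin n) (Fin m) ℝ) (p : EuclideanSpace ℝ (Fin m)) (l : EuclideanSpace ℝ (Fin n))
    (us : EuclideanSpace ℝ (Fin m))
    (h : ∀ uu ∈ ellipsoid p P, ⟪-l, mv B uu⟫ ≤ ⟪-l, mv B us⟫) :
    ⟪l, mv B (us - p)⟫ ≤ -√⟪mv Bᵀ l, mv P (mv Bᵀ l)⟫ := by
  set b := mv Bᵀ l with hb
  set κ := √⟪b, mv P b⟫ with hκ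
  have hκ2 : κ * κ = ⟪b, mv P b⟫ := Real.mul_self_sqrt (posSemidef_inner hP.posSemidef b)
  have hκ0 : 0 ≤ κ := Real.sqrt_nonneg _
  have h1 := h (p - κ⁻¹ • mv P b) (by
    show ⟪_, _⟫ ≤ (1:ℝ)
    have : p - κ⁻¹ • mv P b - p = (-κ⁻¹) • mv P b := by simp
    rw [this, mv_smul, mv_inv_mv (isUnit_det hP), real_inner_smul_left, real_inner_smul_right,
      real_inner_comm, ← hκ2]
    by_cases h0 : κ = 0
    · simp [h0]
    · have : -κ⁻¹ * (-κ⁻¹ * (κ * κ)) = 1 := by field_simp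
      exact this.le)
  rw [mv_sub, inner_sub_right, mv_smul, real_inner_smul_right, inner_neg_left, inner_neg_left,
    inner_neg_left, inner_mv B l (mv P b), ← hb, ← hκ2] at h1
  rw [mv_sub, inner_sub_right]
  by_cases h0 : κ = 0
  · rw [h0] at h1 ⊢; simp at h1; linarith
  · have : κ⁻¹ * -(κ * κ) = -κ := by field_simp
    rw [this] at h1
    linarith

lemma K3 {n : ℕ} {Q Qs : Matrix (Fin n) (Fin n) ℝ} (hs : Qs.PosSemidef) (h : Qs * Qs = Q)
    (z : EuclideanSpace ℝ (Fin n)) : ‖mv Qs z‖ ^ 2 = ⟪z, mv Q z⟫ := by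
  rw [← real_inner_self_eq_norm_sq, ← h, mv_mul, inner_symm (posDef_symm hs) z]

lemma K4 {n : ℕ} {S : Matrix (Fin n) (Fin n) ℝ} (h : Sᵀ * S = 1)
    (z : EuclideanSpace ℝ (Fin n)) : ‖mv S z‖ = ‖z‖ := by
  have : ‖mv S z‖ ^ 2 = ‖z‖ ^ 2 := by
    rw [← real_inner_self_eq_norm_sq, inner_mv, ← mv_mul, h, mv_one, real_inner_self_eq_norm_sq]
  exact (sq_eq_sq₀ (norm_nonneg _) (norm_nonneg _)).1 this

lemma unit_sqrt {n : ℕ} {Q Qs : Matrix (Fin n) (Fin n) ℝ} (hQ : Q.PosDef) (h : Qs * Qs = Q) :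
    IsUnit Qs.det := by
  have := isUnit_det hQ
  rw [← h, Matrix.det_mul] at this
  exact isUnit_of_mul_isUnit_left this

lemma K2 {n m : ℕ} {Q Qs R : Matrix (Fin n) (Fin n) ℝ} {B : Matrix (Fin n) (Fin m) ℝ}
    {P : Matrix (Fin m) (Fin m) ℝ} (hQ : Q.PosDef)
    (hs : Qs.PosSemidef) (h : Qs * Qs = Q) (hR : R.PosSemidef)
    (hR2 : R * R = Qs⁻¹ * (B * P * Bᵀ) * Qs⁻¹)
    (z : EuclideanSpace ℝ (Fin n)) :
    ‖mv R (mv Qs z)‖ = √⟪mv Bᵀ z, mv P (mv Bᵀ z)⟫ := by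
  have hu := unit_sqrt hQ h
  have hss := posDef_symm hs
  rw [← Real.sqrt_sq (norm_nonneg (mv R (mv Qs z)))]
  congr 1
  have hsi : (Qs⁻¹)ᵀ = Qs⁻¹ := by rw [Matrix.transpose_nonsing_inv, hss]
  rw [← real_inner_self_eq_norm_sq, ← inner_symm (posDef_symm hR), ← mv_mul, hR2]
  simp only [mv_mul]
  rw [mv_inv_mv hu, inner_symm hsi, mv_inv_mv hu, inner_mv]

lemma K1 {n : ℕ} {A Q Qs R S : Matrix (Fin n) (Fin n) ℝ} (hQ : Q.PosDef)
    (hs : Qs.PosSemidef) (hR : R.PosSemidef) (z z' : EuclideanSpace ℝ (Fin n)) :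
    ⟪z, mv (A * Q + Q * Aᵀ - Qs * (R * S + Sᵀ * R) * Qs) z'⟫ =
      ⟪mv Aᵀ z, mv Q z'⟫ + ⟪mv Q z, mv Aᵀ z'⟫ - ⟪mv R (mv Qs z), mv S (mv Qs z')⟫
        - ⟪mv S (mv Qs z), mv R (mv Qs z')⟫ := by
  have hQ' := posDef_symm hQ.posSemidef
  have hs' := posDef_symm hs
  have hR' := posDef_symm hR
  simp only [sub_mv, add_mv, mv_mul, inner_sub_right, inner_add_right, mv_add]
  rw [inner_mv A, inner_symm hQ' z, inner_symm hs' z, inner_symm hs' z, inner_symm hR' (mv Qs z),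
    inner_mv Sᵀ, Matrix.transpose_transpose]
  ring

lemma ac_congr {f g : ℝ → ℝ} {a b : ℝ} (hf : AbsolutelyContinuousOnInterval f a b)
    (h : ∀ x ∈ uIcc a b, g x = f x) : AbsolutelyContinuousOnInterval g a b := by
  rw [absolutelyContinuousOnInterval_iff] at hf ⊢
  intro ε hε
  obtain ⟨δ, hδ, H⟩ := hf ε hε
  refine ⟨δ, hδ, fun E hE hs => ?_⟩
  have := H E hE hs
  rwa [Finset.sum_congr rfl fun i hi => by rw [h _ (hE.1 i hi).1, h _ (hE.1 i hi).2]]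

lemma ac_const (c : ℝ) (a b : ℝ) : AbsolutelyContinuousOnInterval (fun _ => c) a b :=
  (LipschitzWith.const c).lipschitzOnWith.absolutelyContinuousOnInterval

lemma ac_sum {ι : Type*} (s : Finset ι) {f : ι → ℝ → ℝ} {a b : ℝ}
    (hf : ∀ i ∈ s, AbsolutelyContinuousOnInterval (f i) a b) :
    AbsolutelyContinuousOnInterval (fun x => ∑ i ∈ s, f i x) a b := by
  classical
  induction s using Finset.induction_on with
  | empty => simpa using ac_const 0 a b
  | insert i s hi ih =>
    simp only [Finset.sum_insert hi]
    exact (hf i (Finset.mem_insert_self _ _)).add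
      (ih fun j hj => hf j (Finset.mem_insert_of_mem hj))

/-- componentwise absolute continuity -/
def ACv {n : ℕ} (X : ℝ → EuclideanSpace ℝ (Fin n)) (a b : ℝ) : Prop :=
  ∀ i, AbsolutelyContinuousOnInterval (fun r => X r i) a b

lemma ACv.sub' {n : ℕ} {X Y : ℝ → EuclideanSpace ℝ (Fin n)} {a b : ℝ} (hX : ACv X a b)
    (hY : ACv Y a b) : ACv (fun r => X r - Y r) a b := fun i => (hX i).sub (hY i)

lemma ACv.inner {n : ℕ} {X Y : ℝ → EuclideanSpace ℝ (Fin n)} {a b : ℝ} (hX : ACv X a b)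
    (hY : ACv Y a b) : AbsolutelyContinuousOnInterval (fun r => ⟪X r, Y r⟫) a b := by
  simp only [inner_eq_sum]
  exact ac_sum _ fun i _ => (hX i).mul (hY i)

lemma ACv.inner_mv {n : ℕ} {X Y : ℝ → EuclideanSpace ℝ (Fin n)}
    {M : ℝ → Matrix (Fin n) (Fin n) ℝ} {a b : ℝ} (hX : ACv X a b)
    (hY : ACv Y a b) (hM : ∀ i j, AbsolutelyContinuousOnInterval (fun r => M r i j) a b) :
    AbsolutelyContinuousOnInterval (fun r => ⟪X r, mv (M r) (Y r)⟫) a b := by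
  simp only [inner_mv_eq_sum]
  exact ac_sum _ fun i _ => ac_sum _ fun j _ => (hX i).mul ((hM i j).mul (hY j))

lemma ac_mono {f : ℝ → ℝ} {a b : ℝ} (hab : a ≤ b) (hf : AbsolutelyContinuousOnInterval f a b)
    (h : ∀ᵐ r, r ∈ Ioo a b → ∀ d, HasDerivAt f d r → 0 ≤ d) : f a ≤ f b := by
  have h1 := hf.integral_deriv_eq_sub
  have h2 : 0 ≤ ∫ x in a..b, deriv f x := by
    apply intervalIntegral.integral_nonneg_of_ae_restrict hab
    rw [Filter.EventuallyLE, ← restrict_Ioo_eq_restrict_Icc, ae_restrict_iff' measurableSet_Ioo]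
    filter_upwards [h, hf.ae_differentiableAt] with r hr hd hm
    exact hr hm _ (hd (by rw [uIcc_of_le hab]; exact Ioo_subset_Icc_self hm)).hasDerivAt
  linarith

lemma lip_of_deriv {f f' : ℝ → ℝ} {a b C : ℝ} (hC : 0 ≤ C)
    (hf : ContinuousOn f (Icc a b))
    (hd : ∀ r ∈ Ioo a b, HasDerivAt f (f' r) r) (hb : ∀ r ∈ Ioo a b, |f' r| ≤ C) :
    LipschitzOnWith C.toNNReal f (Icc a b) := by
  have key : ∀ x ∈ Icc a b, ∀ y ∈ Icc a b, x < y → |f y - f x| ≤ C * (y - x) := by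
    intro x hx y hy hxy
    obtain ⟨c, hc, h⟩ := exists_hasDerivAt_eq_slope f f' hxy
      (hf.mono (Icc_subset_Icc hx.1 hy.2))
      (fun r hr => hd r ⟨hx.1.trans_lt hr.1, hr.2.trans_le hy.2⟩)
    have h3 := hb c ⟨hx.1.trans_lt hc.1, hc.2.trans_le hy.2⟩
    have h4 : 0 < y - x := sub_pos.2 hxy
    rw [h, abs_div, abs_of_pos h4, div_le_iff₀ h4] at h3
    exact h3
  apply LipschitzOnWith.of_dist_le_mul
  intro x hx y hy
  rw [Real.coe_toNNReal _ hC, Real.dist_eq, Real.dist_eq]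
  rcases lt_trichotomy x y with h | h | h
  · rw [abs_sub_comm, abs_sub_comm x y, abs_of_pos (sub_pos.2 h)]; exact key x hx y hy h
  · simp [h]
  · rw [abs_of_pos (sub_pos.2 h)]; exact key y hy x hx h

lemma ac_of_deriv {f f' : ℝ → ℝ} {a b C : ℝ} (hab : a ≤ b)
    (hf : ContinuousOn f (Icc a b))
    (hd : ∀ r ∈ Ioo a b, HasDerivAt f (f' r) r) (hb : ∀ r ∈ Ioo a b, |f' r| ≤ C) :
    AbsolutelyContinuousOnInterval f a b := by
  apply LipschitzOnWith.absolutelyContinuousOnInterval (K := (max C 0).toNNReal)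
  rw [uIcc_of_le hab]
  exact lip_of_deriv (le_max_right _ _) hf hd fun r hr => (hb r hr).trans (le_max_left _ _)

lemma hasDerivAt_coord {n : ℕ} {X : ℝ → EuclideanSpace ℝ (Fin n)} {X' : EuclideanSpace ℝ (Fin n)}
    {r : ℝ} (h : HasDerivAt X X' r) (i : Fin n) : HasDerivAt (fun s => X s i) (X' i) r :=
  ((EuclideanSpace.proj (𝕜 := ℝ) i).hasFDerivAt.comp_hasDerivAt r h :)

lemma hasDerivAt_inner_mv {n : ℕ} {X Y : ℝ → EuclideanSpace ℝ (Fin n)}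
    {M : ℝ → Matrix (Fin n) (Fin n) ℝ} {X' Y' : EuclideanSpace ℝ (Fin n)}
    {M' : Matrix (Fin n) (Fin n) ℝ} {r : ℝ} (hX : HasDerivAt X X' r) (hY : HasDerivAt Y Y' r)
    (hM : ∀ i j, HasDerivAt (fun r => M r i j) (M' i j) r) :
    HasDerivAt (fun r => ⟪X r, mv (M r) (Y r)⟫)
      (⟪X', mv (M r) (Y r)⟫ + ⟪X r, mv M' (Y r)⟫ + ⟪X r, mv (M r) Y'⟫) r := by
  simp only [inner_mv_eq_sum]
  rw [← Finset.sum_add_distrib, ← Finset.sum_add_distrib]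
  refine HasDerivAt.fun_sum fun i _ => ?_
  rw [← Finset.sum_add_distrib, ← Finset.sum_add_distrib]
  refine HasDerivAt.fun_sum fun j _ => ?_
  convert! (hasDerivAt_coord hX i).mul ((hM i j).mul (hasDerivAt_coord hY j)) using 1
  simp only [Pi.mul_apply]
  ring

lemma traj {n : ℕ} {X f : ℝ → EuclideanSpace ℝ (Fin n)} {a b c : ℝ} (hab : a ≤ b)
    (hc : c ∈ Icc a b) (hf : IntervalIntegrable f volume a b) (x0 : EuclideanSpace ℝ (Fin n))
    (h : ∀ r ∈ Icc a b, X r = x0 + ∫ s in c..r, f s) :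
    ACv X a b ∧ ∀ᵐ r, r ∈ Ioo a b → HasDerivAt X (f r) r := by
  have hu : uIcc a b = Icc a b := uIcc_of_le hab
  constructor
  · intro i
    have hfi : IntervalIntegrable (fun r => f r i) volume a b :=
      ⟨(EuclideanSpace.proj (𝕜 := ℝ) i).integrable_comp hf.1,
        (EuclideanSpace.proj (𝕜 := ℝ) i).integrable_comp hf.2⟩
    have h1 := hfi.absolutelyContinuousOnInterval_intervalIntegral (c := c) (by rwa [hu])
    refine ac_congr ((ac_const (x0 i) a b).add h1) fun r hr => ?_
    rw [hu] at hr
    have h2 : IntervalIntegrable f volume c r :=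
      hf.mono_set (by rw [hu]; exact uIcc_subset_Icc hc hr)
    have h3 := (EuclideanSpace.proj (𝕜 := ℝ) i).intervalIntegral_comp_comm h2
    have h4 : (∫ s in c..r, f s) i = ∫ s in c..r, f s i := h3.symm
    rw [h r hr]
    simp [h4]
  · filter_upwards [hf.ae_hasDerivAt_integral] with r hr hm
    have h1 := (hr (by rw [hu]; exact Ioo_subset_Icc_self hm) c (by rwa [hu])).const_add x0
    refine h1.congr_of_eventuallyEq ?_
    filter_upwards [Ioo_mem_nhds hm.1 hm.2] with s hs
    exact h s (Ioo_subset_Icc_self hs)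

instance matPM {k l : ℕ} : TopologicalSpace.PseudoMetrizableSpace (Matrix (Fin k) (Fin l) ℝ) :=
  inferInstanceAs (TopologicalSpace.PseudoMetrizableSpace (Fin k → Fin l → ℝ))

lemma ellipsoid_bdd {m : ℕ} {P : Matrix (Fin m) (Fin m) ℝ} (hP : P.PosDef)
    (p : EuclideanSpace ℝ (Fin m)) : ∃ C, ellipsoid p P ⊆ Metric.closedBall 0 C := by
  refine ⟨‖p‖ + √(∑ i, (√⟪EuclideanSpace.single i (1:ℝ), mv P (EuclideanSpace.single i (1:ℝ))⟫)^2),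
    fun u hu => ?_⟩
  rw [mem_closedBall_zero_iff]
  have h1 : ‖u‖ ≤ ‖p‖ + ‖u - p‖ := by
    calc ‖u‖ = ‖p + (u - p)‖ := by simp
      _ ≤ _ := norm_add_le _ _
  refine h1.trans (add_le_add le_rfl ?_)
  rw [EuclideanSpace.norm_eq]
  refine Real.sqrt_le_sqrt (Finset.sum_le_sum fun i _ => ?_)
  have := cs_abs hP (EuclideanSpace.single i (1:ℝ)) (u - p) hu
  refine pow_le_pow_left₀ (norm_nonneg _) ?_ 2
  simpa [EuclideanSpace.inner_single_left] using this

lemma rhs_integrable {n m : ℕ} {a b : ℝ} (hab : a ≤ b)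
    {A : ℝ → Matrix (Fin n) (Fin n) ℝ} (hA : ContinuousOn A (Icc a b))
    {B : ℝ → Matrix (Fin n) (Fin m) ℝ} (hB : ContinuousOn B (Icc a b))
    {p : EuclideanSpace ℝ (Fin m)} {P : Matrix (Fin m) (Fin m) ℝ} (hP : P.PosDef)
    {u : ℝ → EuclideanSpace ℝ (Fin m)} (hu : Admissible (ellipsoid p P) a b u)
    {X : ℝ → EuclideanSpace ℝ (Fin n)} (hX : ContinuousOn X (Icc a b)) :
    IntervalIntegrable (fun r => mv (A r) (X r) + mv (B r) (u r)) volume a b := by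
  apply IntervalIntegrable.add
  · apply ContinuousOn.intervalIntegrable
    rw [uIcc_of_le hab]
    exact continuous_mv.comp_continuousOn (hA.prodMk hX)
  · rw [intervalIntegrable_iff_integrableOn_Icc_of_le hab]
    obtain ⟨C, hC⟩ := ellipsoid_bdd hP p
    have hK : IsCompact ((B '' Icc a b) ×ˢ Metric.closedBall (0 : EuclideanSpace ℝ (Fin m)) C) :=
      (isCompact_Icc.image_of_continuousOn hB).prod (isCompact_closedBall _ _)
    obtain ⟨D, hD⟩ := hK.exists_bound_of_continuousOn continuous_mv.continuousOn
    refine IntegrableOn.of_bound (by simp) ?_ D ?_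
    · exact Continuous.comp_aestronglyMeasurable₂ (μ := volume.restrict (Icc a b)) (g := fun M x => mv M x) continuous_mv
        (hB.aestronglyMeasurable measurableSet_Icc) hu.1.aestronglyMeasurable
    · rw [ae_restrict_iff' measurableSet_Icc]
      filter_upwards with r hr
      exact hD (B r, u r) ⟨mem_image_of_mem _ hr, hC (hu.2 r hr)⟩

lemma stay_le {f : ℝ → ℝ} {a b : ℝ} (hab : a ≤ b) (hf : AbsolutelyContinuousOnInterval f a b)
    (hb : f b ≤ 1)
    (h : ∀ᵐ r, r ∈ Ioo a b → 1 < f r → ∀ d, HasDerivAt f d r → 0 ≤ d) :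
    ∀ s ∈ Icc a b, f s ≤ 1 := by
  intro s hs
  by_contra hlt
  push Not at hlt
  have hc : ContinuousOn f (Icc s b) := by
    have := hf.continuousOn
    rw [uIcc_of_le hab] at this
    exact this.mono (Icc_subset_Icc_left hs.1)
  set S := {r ∈ Icc s b | f r ≤ 1} with hS
  have hScl : IsClosed S := by
    have := hc.preimage_isClosed_of_isClosed isClosed_Icc (isClosed_Iic (a := (1:ℝ)))
    exact this
  have hne : S.Nonempty := ⟨b, ⟨hs.2, le_rfl⟩, hb⟩
  have hbd : BddBelow S := ⟨s, fun r hr => hr.1.1⟩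
  have hmem := hScl.csInf_mem hne hbd
  set c := sInf S with hcdef
  have h1 : f s ≤ f c := by
    apply ac_mono hmem.1.1
    · apply hf.mono
      rw [uIcc_of_le hab, uIcc_of_le hmem.1.1]
      exact Icc_subset_Icc hs.1 hmem.1.2
    · filter_upwards [h] with r hr hm d hd
      refine hr ⟨hs.1.trans_lt hm.1, hm.2.trans_le hmem.1.2⟩ ?_ d hd
      by_contra hle
      push Not at hle
      exact absurd (csInf_le hbd (show r ∈ S from
        ⟨⟨hm.1.le, hm.2.le.trans hmem.1.2⟩, hle⟩)) (not_le.2 hm.2)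
  have := hmem.2
  linarith

lemma cont_entry {k l : ℕ} {M : ℝ → Matrix (Fin k) (Fin l) ℝ} {s : Set ℝ} (h : ContinuousOn M s)
    (i : Fin k) (j : Fin l) : ContinuousOn (fun r => M r i j) s :=
  ((continuous_id.matrix_elem i j).comp_continuousOn h :)

lemma cont_inv {k : ℕ} {M : ℝ → Matrix (Fin k) (Fin k) ℝ} {s : Set ℝ} (h : ContinuousOn M s)
    (hd : ∀ r ∈ s, IsUnit (M r).det) : ContinuousOn (fun r => (M r)⁻¹) s := by
  have h1 : ContinuousOn (fun r => (M r).det) s :=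
    ((continuous_id.matrix_det).comp_continuousOn h :)
  have h2 : ContinuousOn (fun r => (M r).adjugate) s :=
    ((continuous_id.matrix_adjugate).comp_continuousOn h :)
  have h3 := (h1.inv₀ fun r hr => (hd r hr).ne_zero).smul h2
  refine h3.congr fun r hr => ?_
  rw [Matrix.inv_def, Ring.inverse_eq_inv']; rfl

lemma inv_ac {k : ℕ} {Q : ℝ → Matrix (Fin k) (Fin k) ℝ} {a b : ℝ} (hab : a ≤ b)
    (h : ContinuousOn Q (Icc a b)) (hd : ∀ r ∈ Icc a b, IsUnit (Q r).det)
    (hl : ∀ i j, ∃ K, LipschitzOnWith K (fun r => Q r i j) (Icc a b)) (i j : Fin k) :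
    AbsolutelyContinuousOnInterval (fun r => (Q r)⁻¹ i j) a b := by
  have hW := cont_inv h hd
  have hb : ∀ i j, ∃ C, ∀ r ∈ Icc a b, ‖(Q r)⁻¹ i j‖ ≤ C := fun i j =>
    isCompact_Icc.exists_bound_of_continuousOn (cont_entry hW i j)
  choose C hC using hb
  choose K hK using hl
  have key : ∀ x ∈ Icc a b, ∀ y ∈ Icc a b, dist ((Q x)⁻¹ i j) ((Q y)⁻¹ i j) ≤
      (∑ c, ∑ e, C i c * K c e * C e j) * dist x y := by
    intro x hx y hy
    have h1 : (Q x)⁻¹ - (Q y)⁻¹ = (Q x)⁻¹ * ((Q y - Q x) * (Q y)⁻¹) := by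
      rw [Matrix.sub_mul, Matrix.mul_sub, Matrix.mul_nonsing_inv _ (hd y hy), ← Matrix.mul_assoc,
        Matrix.nonsing_inv_mul _ (hd x hx), Matrix.mul_one, Matrix.one_mul]
    rw [dist_eq_norm, ← Matrix.sub_apply, h1]
    simp only [Matrix.mul_apply, Finset.mul_sum, Finset.sum_mul]
    refine (norm_sum_le _ _).trans (Finset.sum_le_sum fun c _ => ?_)
    refine (norm_sum_le _ _).trans (Finset.sum_le_sum fun e _ => ?_)
    rw [norm_mul, norm_mul, Matrix.sub_apply, ← dist_eq_norm, dist_comm]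
    have h2 := (hK c e).dist_le_mul x hx y hy
    have h3 := hC i c x hx
    have h4 := hC e j y hy
    have h5 := (norm_nonneg _).trans h3
    have h6 := (norm_nonneg _).trans h4
    calc _ ≤ C i c * ((K c e * dist x y) * C e j) := by gcongr
      _ = _ := by ring
  have hnn : 0 ≤ ∑ c, ∑ e, C i c * K c e * C e j := by
    have ha : a ∈ Icc a b := ⟨le_rfl, hab⟩
    refine Finset.sum_nonneg fun c _ => Finset.sum_nonneg fun e _ => ?_
    have h5 := (norm_nonneg _).trans (hC i c a ha)
    have h6 := (norm_nonneg _).trans (hC e j a ha)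
    positivity
  apply LipschitzOnWith.absolutelyContinuousOnInterval
    (K := (∑ c, ∑ e, C i c * K c e * C e j).toNNReal)
  rw [uIcc_of_le hab]
  apply LipschitzOnWith.of_dist_le_mul
  rw [Real.coe_toNNReal _ hnn]
  exact fun x hx y hy => key x hx y hy

lemma V_deriv {n : ℕ} {Q : ℝ → Matrix (Fin n) (Fin n) ℝ} {y : ℝ → EuclideanSpace ℝ (Fin n)}
    {s d : ℝ} {y' : EuclideanSpace ℝ (Fin n)} {Q' : Matrix (Fin n) (Fin n) ℝ}
    (hpos : ∀ᶠ r in nhds s, (Q r).PosDef)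
    (hV : HasDerivAt (fun r => ⟪y r, mv (Q r)⁻¹ (y r)⟫) d s) (hy : HasDerivAt y y' s)
    (hQ : ∀ i j, HasDerivAt (fun r => Q r i j) (Q' i j) s) :
    d = 2 * ⟪mv (Q s)⁻¹ (y s), y'⟫ - ⟪mv (Q s)⁻¹ (y s), mv Q' (mv (Q s)⁻¹ (y s))⟫ := by
  set v := mv (Q s)⁻¹ (y s) with hv
  have h1 := hasDerivAt_inner_mv (hasDerivAt_const s v) (hasDerivAt_const s v) hQ
  have h2 : HasDerivAt (fun r => ⟪v, y r⟫) ⟪v, y'⟫ s := by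
    simpa using (hasDerivAt_const s v).inner ℝ hy
  have h3 := (hV.sub (h2.const_mul 2)).add h1
  have h4 : IsLocalMin ((fun r => ⟪y r, mv (Q r)⁻¹ (y r)⟫) - (fun r => 2 * ⟪v, y r⟫) +
      (fun r => ⟪v, mv (Q r) v⟫)) s := by
    have hps := hpos.self_of_nhds
    filter_upwards [hpos] with r hr
    have e1 : ⟪v, y s⟫ = ⟪y s, v⟫ := real_inner_comm _ _
    have e2 : mv (Q s) v = y s := mv_mv_inv (isUnit_det hps) _
    have e3 := posSemidef_inner hr.inv.posSemidef (y r - mv (Q r) v)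
    have hsy := posDef_symm hr.posSemidef
    rw [mv_sub, mv_inv_mv (isUnit_det hr), inner_sub_left, inner_sub_right, inner_sub_right,
      ← inner_symm hsy, ← inner_symm hsy, mv_mv_inv (isUnit_det hr)] at e3
    have e4 : ⟪v, y r⟫ = ⟪y r, v⟫ := real_inner_comm _ _
    simp only [Pi.add_apply, Pi.sub_apply]
    rw [e2, ← hv]
    linarith
  have h5 := h4.hasDerivAt_eq_zero h3
  simp [mv_zero] at h5
  linarith

set_option maxHeartbeats 2000000 in
/-- A solution of the LTV system generated by Pontryagin's maximum principle from a terminal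
state on the boundary of the terminal ellipsoid stays on the boundary of the
under-approximating ellipsoid `E(qᵢ(s), Qᵢ(s))` and on the boundary of the backwards
reachable set, on all of `[t,T]`. -/
theorem tight_under_approx_ellipsoid {n m : ℕ} (t T : ℝ)
    (ht : 0 ≤ t) (htT : t ≤ T)
    (A : ℝ → Matrix (Fin n) (Fin n) ℝ) (hA : ContinuousOn A (Set.Icc 0 T))
    (B : ℝ → Matrix (Fin n) (Fin m) ℝ) (hB : ContinuousOn B (Set.Icc 0 T))
    (p : EuclideanSpace ℝ (Fin m)) (P : Matrix (Fin m) (Fin m) ℝ) (hP : P.PosDef)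
    (xe : EuclideanSpace ℝ (Fin n)) (Xe : Matrix (Fin n) (Fin n) ℝ) (hXe : Xe.PosDef)
    (qm : ℝ → EuclideanSpace ℝ (Fin n))
    (Qm : ℝ → Matrix (Fin n) (Fin n) ℝ)
    -- `Qs s` is the p.s.d. square root `Qᵢ(s)^{1/2}`
    (Qs : ℝ → Matrix (Fin n) (Fin n) ℝ)
    -- `Rs s` is the p.s.d. square root `𝒬_{i,*}(s)^{1/2}` of
    -- `𝒬_{i,*}(s) = Qᵢ(s)^{-1/2} B(s) P B(s)ᵀ Qᵢ(s)^{-1/2}`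
    (Rs : ℝ → Matrix (Fin n) (Fin n) ℝ)
    (Sm : ℝ → Matrix (Fin n) (Fin n) ℝ)
    (hS_cont : ContinuousOn Sm (Set.Icc 0 T))
    (hS_orth : ∀ s ∈ Set.Icc (0 : ℝ) T, (Sm s)ᵀ * Sm s = 1)
    (hQpos : ∀ s ∈ Set.Icc (0 : ℝ) T, (Qm s).PosDef)
    (hQs : ∀ s ∈ Set.Icc (0 : ℝ) T, (Qs s).PosSemidef ∧ Qs s * Qs s = Qm s)
    (hRs : ∀ s ∈ Set.Icc (0 : ℝ) T,
      (Rs s).PosSemidef ∧ Rs s * Rs s = (Qs s)⁻¹ * (B s * P * (B s)ᵀ) * (Qs s)⁻¹)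
    (hq_cont : ContinuousOn qm (Set.Icc 0 T))
    (hQ_cont : ContinuousOn Qm (Set.Icc 0 T))
    (hq_ode : ∀ s ∈ Set.Ioo (0 : ℝ) T,
      HasDerivAt qm (mv (A s) (qm s) + mv (B s) p) s)
    (hQ_ode : ∀ s ∈ Set.Ioo (0 : ℝ) T, ∀ j k : Fin n,
      HasDerivAt (fun r => Qm r j k)
        ((A s * Qm s + Qm s * (A s)ᵀ -
          Qs s * (Rs s * Sm s + (Sm s)ᵀ * Rs s) * Qs s) j k) s)
    (hqT : qm T = xe) (hQT : Qm T = Xe)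
    (xstar : ℝ → EuclideanSpace ℝ (Fin n)) (ustar : ℝ → EuclideanSpace ℝ (Fin m))
    (hu : Admissible (ellipsoid p P) t T ustar)
    (hx_cont : ContinuousOn xstar (Set.Icc t T))
    (hx : ∀ s ∈ Set.Icc t T,
      xstar s = xstar T - ∫ r in s..T, (mv (A r) (xstar r) + mv (B r) (ustar r)))
    (lam : ℝ → EuclideanSpace ℝ (Fin n))
    (hlam_cont : ContinuousOn lam (Set.Icc t T))
    (hlam : ∀ s ∈ Set.Icc t T, lam s = lam T + ∫ r in s..T, mv ((A r)ᵀ) (lam r))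
    (humax : ∀ᵐ s ∂(volume.restrict (Set.Ioo t T)),
      ∀ uu ∈ ellipsoid p P, ⟪-(lam s), mv (B s) uu⟫ ≤ ⟪-(lam s), mv (B s) (ustar s)⟫)
    (hxT : ⟪xstar T - xe, mv Xe⁻¹ (xstar T - xe)⟫ = 1)
    (hlamT : lam T = (2 : ℝ) • mv Xe⁻¹ (xstar T - xe))
    (hSw : ∀ s ∈ Set.Icc t T,
      mv (Rs s) (mv (Qs s)⁻¹ (xstar s - qm s)) ≠ 0 →
        ‖mv (Qs s)⁻¹ (xstar s - qm s)‖⁻¹ • mv (Sm s) (mv (Qs s)⁻¹ (xstar s - qm s)) =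
          ‖mv (Rs s) (mv (Qs s)⁻¹ (xstar s - qm s))‖⁻¹ •
            mv (Rs s) (mv (Qs s)⁻¹ (xstar s - qm s))) :
    ∀ s ∈ Set.Icc t T,
      ⟪xstar s - qm s, mv (Qm s)⁻¹ (xstar s - qm s)⟫ = 1 ∧
      xstar s ∈ frontier (ReachLTV A B p P xe Xe T s) := by
  have hsub : Icc t T ⊆ Icc 0 T := Icc_subset_Icc_left ht
  have hsubo : Ioo t T ⊆ Ioo 0 T := Ioo_subset_Ioo_left ht
  have hA' := hA.mono hsub
  have hB' := hB.mono hsub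
  have htm : t ∈ Icc t T := ⟨le_rfl, htT⟩
  have hTm : T ∈ Icc t T := ⟨htT, le_rfl⟩
  have hT0 := hsub hTm
  -- the trajectory
  have hxi := rhs_integrable htT hA' hB' hP hu hx_cont
  obtain ⟨hxac, hxd⟩ := traj (X := xstar) (c := T) htT hTm hxi (xstar T) (fun r hr => by
    rw [hx r hr, intervalIntegral.integral_symm]; abel)
  -- the adjoint
  have hlc : ContinuousOn (fun r => -mv ((A r)ᵀ) (lam r)) (Icc t T) :=
    (continuous_mv.comp_continuousOn
      (((continuous_id.matrix_transpose).comp_continuousOn hA').prodMk hlam_cont)).neg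
  have hli : IntervalIntegrable (fun r => -mv ((A r)ᵀ) (lam r)) volume t T := by
    apply ContinuousOn.intervalIntegrable; rwa [uIcc_of_le htT]
  have hlam2 : ∀ r ∈ Icc t T, lam r = lam T + ∫ s in T..r, -mv ((A s)ᵀ) (lam s) := fun r hr => by
    rw [intervalIntegral.integral_neg, intervalIntegral.integral_symm, neg_neg]; exact hlam r hr
  have hlac : ACv lam t T := (traj (c := T) htT hTm hli (lam T) hlam2).1
  have hld : ∀ r ∈ Ioo t T, HasDerivAt lam (-mv ((A r)ᵀ) (lam r)) r := by
    intro r hr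
    have hr' := Ioo_subset_Icc_self hr
    have h1 : IntervalIntegrable (fun r => -mv ((A r)ᵀ) (lam r)) volume T r :=
      hli.mono_set (by rw [uIcc_of_le htT]; exact uIcc_subset_Icc hTm hr')
    have h2 := intervalIntegral.integral_hasDerivAt_right h1
      (hlc.mono Ioo_subset_Icc_self |>.stronglyMeasurableAtFilter isOpen_Ioo r hr)
      (hlc.continuousAt (Icc_mem_nhds hr.1 hr.2))
    refine (h2.const_add (lam T)).congr_of_eventuallyEq ?_
    filter_upwards [Ioo_mem_nhds hr.1 hr.2] with s hs
    exact hlam2 s (Ioo_subset_Icc_self hs)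
  -- centre
  have hqac : ACv qm t T := by
    intro i
    have hc : ContinuousOn (fun r => (mv (A r) (qm r) + mv (B r) p) i) (Icc t T) := by
      have h1 : ContinuousOn (fun r => mv (A r) (qm r) + mv (B r) p) (Icc t T) :=
        (continuous_mv.comp_continuousOn (hA'.prodMk (hq_cont.mono hsub))).add
          (continuous_mv.comp_continuousOn (hB'.prodMk continuousOn_const))
      exact ((EuclideanSpace.proj (𝕜 := ℝ) i).continuous.comp_continuousOn h1 :)
    obtain ⟨C, hC⟩ := isCompact_Icc.exists_bound_of_continuousOn hc
    refine ac_of_deriv htT ?_ (fun r hr => hasDerivAt_coord (hq_ode r (hsubo hr)) i)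
      (fun r hr => hC r (Ioo_subset_Icc_self hr))
    exact ((EuclideanSpace.proj (𝕜 := ℝ) i).continuous.comp_continuousOn (hq_cont.mono hsub) :)
  have hyac : ACv (fun r => xstar r - qm r) t T := hxac.sub' hqac
  have hyd : ∀ᵐ r, r ∈ Ioo t T → HasDerivAt (fun r => xstar r - qm r)
      (mv (A r) (xstar r - qm r) + mv (B r) (ustar r - p)) r := by
    filter_upwards [hxd] with r hr hm
    refine ((hr hm).sub (hq_ode r (hsubo hm))).congr_deriv ?_
    rw [mv_sub, mv_sub]; abel
  have humax' : ∀ᵐ r, r ∈ Ioo t T →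
      ∀ uu ∈ ellipsoid p P, ⟪-(lam r), mv (B r) uu⟫ ≤ ⟪-(lam r), mv (B r) (ustar r)⟫ :=
    (ae_restrict_iff' measurableSet_Ioo).1 humax
  -- continuity of z ↦ zᵀ B P Bᵀ z
  have hκc : ∀ z : ℝ → EuclideanSpace ℝ (Fin n), ContinuousOn z (Icc t T) →
      ContinuousOn (fun r => √⟪mv (B r)ᵀ (z r), mv P (mv (B r)ᵀ (z r))⟫) (Icc t T) := by
    intro z hz
    have h1 : ContinuousOn (fun r => mv (B r)ᵀ (z r)) (Icc t T) :=
      continuous_mv.comp_continuousOn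
        (((continuous_id.matrix_transpose).comp_continuousOn hB').prodMk hz)
    exact (h1.inner (continuous_mv.comp_continuousOn (continuousOn_const.prodMk h1))).sqrt
  -- entries of Q are Lipschitz
  have hQlip : ∀ i j, ∃ K, LipschitzOnWith K (fun r => Qm r i j) (Icc t T) := by
    intro i j
    let e : Fin n → EuclideanSpace ℝ (Fin n) := fun i => EuclideanSpace.single i (1:ℝ)
    have hent : ∀ (M : Matrix (Fin n) (Fin n) ℝ), M i j = ⟪e i, mv M (e j)⟫ := by
      intro M
      simp [e, EuclideanSpace.inner_single_left, mv_apply]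
    let κ : Fin n → ℝ → ℝ := fun i r => √⟪mv (B r)ᵀ (e i), mv P (mv (B r)ᵀ (e i))⟫
    let ν : Fin n → ℝ → ℝ := fun i r => √⟪e i, mv (Qm r) (e i)⟫
    have hκ : ∀ i, ContinuousOn (κ i) (Icc t T) := fun i => hκc (fun _ => e i) continuousOn_const
    have hν : ∀ i, ContinuousOn (ν i) (Icc t T) := fun i =>
      (continuousOn_const.inner (continuous_mv.comp_continuousOn
        ((hQ_cont.mono hsub).prodMk continuousOn_const))).sqrt
    have hAQ : ContinuousOn (fun r => ⟪mv (A r)ᵀ (e i), mv (Qm r) (e j)⟫ +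
        ⟪mv (Qm r) (e i), mv (A r)ᵀ (e j)⟫) (Icc t T) := by
      have h1 : ∀ i, ContinuousOn (fun r => mv (A r)ᵀ (e i)) (Icc t T) := fun i =>
        continuous_mv.comp_continuousOn
          (((continuous_id.matrix_transpose).comp_continuousOn hA').prodMk continuousOn_const)
      have h2 : ∀ i, ContinuousOn (fun r => mv (Qm r) (e i)) (Icc t T) := fun i =>
        continuous_mv.comp_continuousOn ((hQ_cont.mono hsub).prodMk continuousOn_const)
      exact ((h1 i).inner (h2 j)).add ((h2 i).inner (h1 j))
    have hbig := ((hAQ.abs).add ((hκ i).mul (hν j))).add ((hν i).mul (hκ j))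
    obtain ⟨C, hC⟩ := isCompact_Icc.exists_bound_of_continuousOn hbig
    refine ⟨_, lip_of_deriv (C := max C 0) (le_max_right _ _) (cont_entry (hQ_cont.mono hsub) i j)
      (fun r hr => hQ_ode r (hsubo hr) i j) fun r hr => le_max_of_le_left ?_⟩
    have hr' := Ioo_subset_Icc_self hr
    have hr0 := hsub hr'
    refine le_trans ?_ ((le_abs_self _).trans (hC r hr'))
    rw [hent (A r * Qm r + Qm r * (A r)ᵀ - Qs r * (Rs r * Sm r + (Sm r)ᵀ * Rs r) * Qs r),
      K1 (hQpos r hr0) (hQs r hr0).1 (hRs r hr0).1]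
    have g1 : ∀ i, ‖mv (Rs r) (mv (Qs r) (e i))‖ = κ i r := fun i =>
      K2 (hQpos r hr0) (hQs r hr0).1 (hQs r hr0).2 (hRs r hr0).1 (hRs r hr0).2 _
    have g2 : ∀ i, ‖mv (Sm r) (mv (Qs r) (e i))‖ = ν i r := fun i => by
      rw [K4 (hS_orth r hr0)]
      show _ = √_
      rw [← K3 (hQs r hr0).1 (hQs r hr0).2, Real.sqrt_sq (norm_nonneg _)]
    have g3 := abs_real_inner_le_norm (mv (Rs r) (mv (Qs r) (e i))) (mv (Sm r) (mv (Qs r) (e j)))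
    have g4 := abs_real_inner_le_norm (mv (Sm r) (mv (Qs r) (e i))) (mv (Rs r) (mv (Qs r) (e j)))
    rw [g1, g2] at g3 g4
    refine (abs_sub _ _).trans ?_
    refine add_le_add ((abs_sub _ _).trans (add_le_add le_rfl g3)) g4
  have hQd : ∀ r ∈ Icc t T, IsUnit (Qm r).det := fun r hr => isUnit_det (hQpos r (hsub hr))
  -- V ≤ 1
  have hVac := hyac.inner_mv hyac (inv_ac htT (hQ_cont.mono hsub) hQd hQlip)
  have hVle := stay_le htT hVac (by simp only [hqT, hQT]; exact hxT.le) (by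
    filter_upwards [hyd] with r hr hm hgt d hd
    have hr' := Ioo_subset_Icc_self hm
    have hr0 := hsub hr'
    have hy' := hr hm
    have hdd := V_deriv (by
      filter_upwards [Ioo_mem_nhds hm.1 hm.2] with s hs
      exact hQpos s (hsub (Ioo_subset_Icc_self hs))) hd hy' (hQ_ode r (hsubo hm))
    obtain ⟨hs1, hs2⟩ := hQs r hr0
    obtain ⟨hR1, hR2⟩ := hRs r hr0
    have hSr := hSw r hr'
    have huu := unit_sqrt (hQpos r hr0) hs2
    set v := mv (Qm r)⁻¹ (xstar r - qm r) with hv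
    have hQv : mv (Qm r) v = xstar r - qm r := mv_mv_inv (hQd r hr') _
    have hw : mv (Qs r)⁻¹ (xstar r - qm r) = mv (Qs r) v := by
      rw [← hQv, ← hs2, mv_mul, mv_inv_mv huu]
    rw [hw] at hSr
    set w := mv (Qs r) v with hwdef
    rw [K1 (hQpos r hr0) hs1 hR1, inner_add_right, inner_mv (A r), hQv, ← hwdef,
      real_inner_comm (mv (A r)ᵀ v) (xstar r - qm r), 
      real_inner_comm (mv (Rs r) w) (mv (Sm r) w)] at hdd
    have hw1 : 1 < ‖w‖ := by
      have := K3 hs1 hs2 v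
      rw [hQv, real_inner_comm, ← hwdef] at this
      rw [← this] at hgt
      nlinarith [norm_nonneg w]
    have hin : ⟪mv (Rs r) w, mv (Sm r) w⟫ = ‖w‖ * ‖mv (Rs r) w‖ := by
      by_cases h0 : mv (Rs r) w = 0
      · simp [h0]
      · have h1 := hSr h0
        have hn : ‖w‖ ≠ 0 := by linarith
        have hn2 : ‖mv (Rs r) w‖ ≠ 0 := norm_ne_zero_iff.2 h0
        have h2 : mv (Sm r) w = (‖w‖ * ‖mv (Rs r) w‖⁻¹) • mv (Rs r) w := by
          rw [mul_smul, ← h1, smul_smul, mul_inv_cancel₀ hn, one_smul]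
        rw [h2, real_inner_smul_right, real_inner_self_eq_norm_sq]
        field_simp
    have hbu : -‖mv (Rs r) w‖ ≤ ⟪v, mv (B r) (ustar r - p)⟫ := by
      rw [inner_mv, K2 (hQpos r hr0) hs1 hs2 hR1 hR2]
      exact (abs_le.1 (cs_abs hP (mv (B r)ᵀ v) (ustar r - p) (hu.2 r hr'))).1
    rw [hin] at hdd
    nlinarith [norm_nonneg (mv (Rs r) w)])
  -- g = ⟨λ, y⟩
  have hgac : AbsolutelyContinuousOnInterval (fun r => ⟪lam r, xstar r - qm r⟫) t T :=
    hlac.inner hyac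
  have hgd : ∀ᵐ r, r ∈ Ioo t T → HasDerivAt (fun r => ⟪lam r, xstar r - qm r⟫)
      ⟪lam r, mv (B r) (ustar r - p)⟫ r := by
    filter_upwards [hyd] with r hr hm
    refine ((hld r hm).inner ℝ (hr hm)).congr_deriv ?_
    rw [inner_add_right, inner_mv (A r), inner_neg_left]; ring
  have hgd2 : ∀ᵐ r, r ∈ Ioo t T → ⟪lam r, mv (B r) (ustar r - p)⟫ ≤
      -√⟪mv (B r)ᵀ (lam r), mv P (mv (B r)ᵀ (lam r))⟫ := by
    filter_upwards [humax'] with r hr hm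
    exact max_attained hP _ _ _ _ (hr hm)
  have hgT : ⟪lam T, xstar T - qm T⟫ = 2 := by
    rw [hlamT, hqT, real_inner_smul_left, real_inner_comm, hxT]; norm_num
  have hg2 : ∀ s ∈ Icc t T, 2 ≤ ⟪lam s, xstar s - qm s⟫ := by
    intro s hs
    have h1 := ac_mono hs.2 (f := fun r => -⟪lam r, xstar r - qm r⟫) (hgac.neg.mono (by
      rw [uIcc_of_le htT, uIcc_of_le hs.2]; exact Icc_subset_Icc_left hs.1)) (by
      filter_upwards [hgd, hgd2] with r h1 h2 hm d hd
      have hm' : r ∈ Ioo t T := ⟨hs.1.trans_lt hm.1, hm.2⟩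
      have := hd.unique (h1 hm').neg
      have h3 := h2 hm'
      have h4 := Real.sqrt_nonneg ⟪mv (B r)ᵀ (lam r), mv P (mv (B r)ᵀ (lam r))⟫
      linarith)
    simp only [hgT] at h1
    linarith
  have hl0 : ∀ s ∈ Icc t T, lam s ≠ 0 := by
    intro s hs h0
    have := hg2 s hs
    rw [h0, inner_zero_left] at this
    linarith
  -- N = ⟨λ, Qλ⟩
  have hNpos : ∀ s ∈ Icc t T, 0 < ⟪lam s, mv (Qm s) (lam s)⟫ := fun s hs =>
    posDef_inner (hQpos s (hsub hs)) (hl0 s hs)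
  have hNd : ∀ r ∈ Ioo t T, ∃ d, HasDerivAt (fun r => √⟪lam r, mv (Qm r) (lam r)⟫) d r ∧
      |d| ≤ √⟪mv (B r)ᵀ (lam r), mv P (mv (B r)ᵀ (lam r))⟫ := by
    intro r hm
    have hr' := Ioo_subset_Icc_self hm
    have hr0 := hsub hr'
    obtain ⟨hs1, hs2⟩ := hQs r hr0
    obtain ⟨hR1, hR2⟩ := hRs r hr0
    have h1 := hasDerivAt_inner_mv (hld r hm) (hld r hm) (hQ_ode r (hsubo hm))
    have h2 := h1.sqrt (hNpos r hr').ne'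
    refine ⟨_, h2, ?_⟩
    rw [K1 (hQpos r hr0) hs1 hR1, mv_neg, inner_neg_left, inner_neg_right,
      ← K2 (hQpos r hr0) hs1 hs2 hR1 hR2, ← K3 hs1 hs2, Real.sqrt_sq (norm_nonneg _),
      inner_symm (posDef_symm (hQpos r hr0).posSemidef) (lam r),
      real_inner_comm (mv (Rs r) (mv (Qs r) (lam r))) (mv (Sm r) (mv (Qs r) (lam r)))]
    have h3 : 0 < ‖mv (Qs r) (lam r)‖ := by
      have := hNpos r hr'
      rw [← K3 hs1 hs2] at this
      exact (norm_nonneg _).lt_of_ne fun h => by rw [← h] at this; norm_num at this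
    have h4 := abs_real_inner_le_norm (mv (Rs r) (mv (Qs r) (lam r))) (mv (Sm r) (mv (Qs r) (lam r)))
    rw [K4 (hS_orth r hr0)] at h4
    rw [abs_div, abs_of_pos (by positivity : 0 < 2 * ‖mv (Qs r) (lam r)‖),
      div_le_iff₀ (by positivity)]
    have h5 := abs_le.1 h4
    rw [abs_le]
    constructor <;> linarith [h5.1, h5.2]
  choose! N' hN' hNb using hNd
  have hNac : AbsolutelyContinuousOnInterval (fun r => √⟪lam r, mv (Qm r) (lam r)⟫) t T := by
    obtain ⟨C, hC⟩ := isCompact_Icc.exists_bound_of_continuousOn (hκc lam hlam_cont)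
    refine ac_of_deriv (C := C) htT ?_ hN' fun r hr => (hNb r hr).trans ?_
    · exact (hlam_cont.inner (continuous_mv.comp_continuousOn
        ((hQ_cont.mono hsub).prodMk hlam_cont))).sqrt
    · exact (le_abs_self _).trans (hC r (Ioo_subset_Icc_self hr))
  have hNT : √⟪lam T, mv (Qm T) (lam T)⟫ = 2 := by
    rw [hQT, hlamT, mv_smul, mv_mv_inv (isUnit_det hXe), real_inner_smul_left,
      real_inner_smul_right, real_inner_comm, hxT]
    rw [show (2:ℝ) * (2 * 1) = 2 ^ 2 by norm_num, Real.sqrt_sq (by norm_num)]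
  have hNg : ∀ s ∈ Icc t T, √⟪lam s, mv (Qm s) (lam s)⟫ ≤ ⟪lam s, xstar s - qm s⟫ := by
    intro s hs
    have h1 := ac_mono hs.2
      (f := fun r => √⟪lam r, mv (Qm r) (lam r)⟫ - ⟪lam r, xstar r - qm r⟫)
      ((hNac.sub hgac).mono (by
        rw [uIcc_of_le htT, uIcc_of_le hs.2]; exact Icc_subset_Icc_left hs.1)) (by
      filter_upwards [hgd, hgd2] with r h1 h2 hm d hd
      have hm' : r ∈ Ioo t T := ⟨hs.1.trans_lt hm.1, hm.2⟩
      have h5 := hd.unique ((hN' r hm').sub (h1 hm'))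
      have h3 := h2 hm'
      have h4 := (abs_le.1 (hNb r hm')).1
      linarith)
    simp only [hgT, hNT] at h1
    linarith
  intro s hs
  constructor
  · apply le_antisymm (hVle s hs)
    have h1 := cs_sq (hQpos s (hsub hs)) (lam s) (xstar s - qm s)
    have h2 := hNg s hs
    have h3 := hNpos s hs
    have h4 : ⟪lam s, mv (Qm s) (lam s)⟫ ≤ ⟪lam s, xstar s - qm s⟫ ^ 2 := by
      rw [← Real.sq_sqrt h3.le]
      exact pow_le_pow_left₀ (Real.sqrt_nonneg _) h2 2
    by_contra hlt
    push Not at hlt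
    nlinarith
  · have hss : Icc s T ⊆ Icc t T := Icc_subset_Icc_left hs.1
    have hus : Admissible (ellipsoid p P) s T ustar := ⟨hu.1, fun r hr => hu.2 r (hss hr)⟩
    have hmem : xstar s ∈ ReachLTV A B p P xe Xe T s := by
      refine ⟨ustar, xstar, hus, hx_cont.mono hss, fun r hr => ?_, hxT.le⟩
      have i1 := hxi.mono_set (c := s) (d := r)
        (by rw [uIcc_of_le htT]; exact uIcc_subset_Icc hs (hss hr))
      have i2 := hxi.mono_set (c := r) (d := T)
        (by rw [uIcc_of_le htT]; exact uIcc_subset_Icc (hss hr) hTm)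
      have := intervalIntegral.integral_add_adjacent_intervals i1 i2
      rw [hx r (hss hr), hx s hs, ← this]; abel
    have hhalf : ∀ x ∈ ReachLTV A B p P xe Xe T s, ⟪lam s, x - xstar s⟫ ≤ 0 := by
      rintro x ⟨u, X, hua, hXc, hXi, hXT⟩
      have hsm : s ∈ Icc s T := ⟨le_rfl, hs.2⟩
      have hXs : X s = x := by simpa using hXi s hsm
      obtain ⟨hXac, hXd⟩ := traj hs.2 hsm
        (rhs_integrable hs.2 (hA'.mono hss) (hB'.mono hss) hP hua hXc) x hXi
      have hsu : uIcc s T ⊆ uIcc t T := by rwa [uIcc_of_le htT, uIcc_of_le hs.2]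
      have hlac' : ACv lam s T := fun i => (hlac i).mono hsu
      have hxac' : ACv xstar s T := fun i => (hxac i).mono hsu
      have h1 := ac_mono hs.2 (hlac'.inner (hXac.sub' hxac')) (by
        filter_upwards [hXd, hxd, humax'] with r h1 h2 h3 hm d hd
        have hm' : r ∈ Ioo t T := ⟨hs.1.trans_lt hm.1, hm.2⟩
        have h5 := hd.unique ((hld r hm').inner ℝ ((h1 hm).sub (h2 hm')))
        have h6 := h3 hm' (u r) (hua.2 r (Ioo_subset_Icc_self hm))
        rw [inner_neg_left, inner_neg_left] at h6
        rw [inner_sub_right, inner_add_right, inner_add_right, inner_mv (A r), inner_mv (A r),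
          inner_neg_left, inner_sub_right] at h5
        linarith)
      simp only [hXs] at h1
      refine h1.trans ?_
      have h2 := cs_abs hXe (mv Xe⁻¹ (xstar T - xe)) (X T - xe) hXT
      rw [mv_mv_inv (isUnit_det hXe), real_inner_comm (xstar T - xe) (mv Xe⁻¹ (xstar T - xe)), hxT,
        Real.sqrt_one] at h2
      have h3 := (abs_le.1 h2).2
      rw [hlamT, real_inner_smul_left, show X T - xstar T = (X T - xe) - (xstar T - xe) by abel,
        inner_sub_right, real_inner_comm (xstar T - xe), hxT]
      linarith
    rw [frontier, mem_sdiff]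
    refine ⟨subset_closure hmem, fun hint => ?_⟩
    rw [mem_interior_iff_mem_nhds] at hint
    have hc : Filter.Tendsto (fun ε : ℝ => xstar s + ε • lam s) (nhds 0) (nhds (xstar s)) := by
      have : Continuous (fun ε : ℝ => xstar s + ε • lam s) := by fun_prop
      simpa using this.tendsto 0
    have h1 := hc.eventually hint
    obtain ⟨δ, hδ, h2⟩ := Metric.eventually_nhds_iff.1 h1
    have h3 := hhalf _ (h2 (y := δ / 2) (by rw [Real.dist_eq, sub_zero, abs_of_pos] <;> linarith))
    rw [add_sub_cancel_left, real_inner_smul_right, real_inner_self_eq_norm_sq] at h3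
    have h4 : 0 < ‖lam s‖ := norm_pos_iff.2 (hl0 s hs)
    have : 0 < δ / 2 * ‖lam s‖ ^ 2 := by positivity
    linarith

end
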